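/- Let A be a simple C*-algebra which is not of type I, let a ∈ A₊ be nonzero, and let l be a positive integer. Then there exist nonzero positive elements b₁, …, b_l ∈ A with b₁ ∼_A b₂ ∼_A ⋯ ∼_A b_l (pairwise Cuntz equivalent in A), bⱼ b_k = 0 for j ≠ k, and b₁ + ⋯ + b_l contained in the hereditary subalgebra closure(a A a). -/

import Mathlib

open Filter Topology

/-- Cuntz subequivalence: `a ≾ b` iff there is a sequence `vₙ` with `vₙ b vₙ* → a`. -/
def CuntzSubequiv (A : Type*) [Mul A] [Star A] [TopologicalSpace A] (a b : A) : Prop :=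
  ∃ v : ℕ → A, Tendsto (fun n => v n * b * star (v n)) atTop (𝓝 a)

/-- Cuntz equivalence: mutual Cuntz subequivalence. -/
def CuntzEquiv (A : Type*) [Mul A] [Star A] [TopologicalSpace A] (a b : A) : Prop :=
  CuntzSubequiv A a b ∧ CuntzSubequiv A b a

/-- A representation `π : A → B(H)` is irreducible if it is nonzero and the only closed
invariant subspaces are `⊥` and `⊤`. -/
def IsIrreducibleRep {A H : Type} [NonUnitalCStarAlgebra A] [NormedAddCommGroup H]
    [InnerProductSpace ℂ H] [CompleteSpace H] (π : A →⋆ₙₐ[ℂ] (H →L[ℂ] H)) : Prop :=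
  π ≠ 0 ∧
    ∀ S : Submodule ℂ H, IsClosed (S : Set H) →
      (∀ (a : A) (v : H), v ∈ S → π a v ∈ S) → S = ⊥ ∨ S = ⊤

/-- A C*-algebra is of type I (GCR) if every irreducible representation contains
the compact operators in its range. -/
def IsTypeI (A : Type) [NonUnitalCStarAlgebra A] : Prop :=
  ∀ (H : Type) [NormedAddCommGroup H] [InnerProductSpace ℂ H] [CompleteSpace H]
    (π : A →⋆ₙₐ[ℂ] (H →L[ℂ] H)), IsIrreducibleRep π →
    ∀ K : H →L[ℂ] H, IsCompactOperator K → K ∈ Set.range π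

namespace OrthEq

open scoped InnerProductSpace

section Cuntz

variable {A : Type} [NonUnitalCStarAlgebra A]

lemma sub_conj (x v : A) : CuntzSubequiv A (v * x * star v) x :=
  ⟨fun _ => v, tendsto_const_nhds⟩

lemma sub_trans {x y z : A} (h1 : CuntzSubequiv A x y) (h2 : CuntzSubequiv A y z) :
    CuntzSubequiv A x z := by
  obtain ⟨v, hv⟩ := h1
  obtain ⟨w, hw⟩ := h2
  have key : x ∈ closure {t : A | ∃ u, t = u * z * star u} := by
    have h : ∀ n, v n * y * star (v n) ∈ closure {t : A | ∃ u, t = u * z * star u} := by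
      intro n
      have h3 : Tendsto (fun m => v n * (w m * z * star (w m)) * star (v n)) atTop
          (𝓝 (v n * y * star (v n))) := (hw.const_mul _).mul_const _
      refine mem_closure_of_tendsto h3 (Eventually.of_forall fun m => ⟨v n * w m, ?_⟩)
      simp [mul_assoc]
    have := mem_closure_of_tendsto hv (Eventually.of_forall h)
    rwa [closure_closure] at this
  obtain ⟨t, ht, hlim⟩ := mem_closure_iff_seq_limit.1 key
  choose u hu using ht
  exact ⟨u, by simpa [← hu] using hlim⟩

lemma ne_zero_of_sub {x y : A} (h : CuntzSubequiv A x y) (hx : x ≠ 0) : y ≠ 0 := by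
  rintro rfl
  obtain ⟨v, hv⟩ := h
  simp only [mul_zero, zero_mul] at hv
  exact hx (tendsto_nhds_unique hv tendsto_const_nhds)

lemma approx_inv {d : A} (hd : IsSelfAdjoint d) :
    ∃ v : ℕ → A, Tendsto (fun n => v n * d * d) atTop (𝓝 d) := by
  refine ⟨fun n => cfcₙ (fun t : ℝ => t / (t ^ 2 + 1 / ((n : ℝ) + 1) ^ 2)) d, ?_⟩
  rw [tendsto_iff_norm_sub_tendsto_zero]
  refine squeeze_zero (fun _ => norm_nonneg _) (g := fun n : ℕ => 1 / ((n : ℝ) + 1)) ?_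
    tendsto_one_div_add_atTop_nhds_zero_nat
  intro n
  set ε : ℝ := 1 / ((n : ℝ) + 1) with hε
  have hε0 : 0 < ε := by positivity
  have h2 : 1 / ((n : ℝ) + 1) ^ 2 = ε ^ 2 := by rw [hε]; field_simp
  simp only [h2]
  have hc : Continuous (fun t : ℝ => t / (t ^ 2 + ε ^ 2)) := by
    refine continuous_id.div (by fun_prop) fun t => by positivity
  have e1 : cfcₙ (fun t : ℝ => t / (t ^ 2 + ε ^ 2)) d * d * d - d
      = cfcₙ (fun t : ℝ => t / (t ^ 2 + ε ^ 2) * t * t - t) d := by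
    rw [cfcₙ_sub (fun t : ℝ => t / (t ^ 2 + ε ^ 2) * t * t) (fun t => t) d
        (by first | exact hc.continuousOn | exact (hc.mul continuous_id).continuousOn
                  | exact ((hc.mul continuous_id).mul continuous_id).continuousOn)
        (by simp) (by fun_prop) (by simp),
      cfcₙ_mul (fun t : ℝ => t / (t ^ 2 + ε ^ 2) * t) (fun t => t) d
        (by first | exact hc.continuousOn | exact (hc.mul continuous_id).continuousOn
                  | exact ((hc.mul continuous_id).mul continuous_id).continuousOn)
        (by simp) (by fun_prop) (by simp),
      cfcₙ_mul (fun t : ℝ => t / (t ^ 2 + ε ^ 2)) (fun t => t) d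
        (by first | exact hc.continuousOn | exact (hc.mul continuous_id).continuousOn
                  | exact ((hc.mul continuous_id).mul continuous_id).continuousOn)
        (by simp) (by fun_prop) (by simp), cfcₙ_id' ℝ d]
  rw [e1]
  refine norm_cfcₙ_le fun t _ => ?_
  have e2 : t / (t ^ 2 + ε ^ 2) * t * t - t = - (ε ^ 2 * t) / (t ^ 2 + ε ^ 2) := by
    field_simp; ring
  rw [e2, Real.norm_eq_abs, abs_div, abs_neg, abs_of_pos (a := t ^ 2 + ε ^ 2) (by positivity),
    div_le_iff₀ (by positivity), abs_mul, abs_of_pos (a := ε ^ 2) (by positivity)]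
  have := sq_abs t
  nlinarith [mul_nonneg hε0.le (sq_nonneg (|t| - ε)), mul_nonneg hε0.le (sq_nonneg t),
    mul_nonneg hε0.le (sq_nonneg ε), mul_nonneg hε0.le (mul_nonneg hε0.le (abs_nonneg t))]

lemma sub_compress {d : A} (hd : IsSelfAdjoint d) (s : A) :
    CuntzSubequiv A (d * s * d) (d * (d * s * d) * d) := by
  obtain ⟨v, hv⟩ := approx_inv hd
  refine ⟨v, ?_⟩
  have h := (hv.mul_const s).mul hv.star
  simp only [star_mul, hd.star_eq] at h
  simpa [mul_assoc] using h

end Cuntz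

section Rep

variable {A H : Type} [NonUnitalCStarAlgebra A] [NormedAddCommGroup H]
    [InnerProductSpace ℂ H] [CompleteSpace H] {π : A →⋆ₙₐ[ℂ] (H →L[ℂ] H)}

lemma inner_rep (x : A) (u v : H) : ⟪π (star x) u, v⟫_ℂ = ⟪u, π x v⟫_ℂ := by
  rw [map_star, ContinuousLinearMap.star_eq_adjoint, ContinuousLinearMap.adjoint_inner_left]

lemma rep_sa_ne {e : A} (he : IsSelfAdjoint e) {ξ : H} (h : π e ξ ≠ 0) : π e (π e ξ) ≠ 0 := by
  intro h0
  apply h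
  have := inner_rep (π := π) e (π e ξ) ξ
  rw [he.star_eq, h0, inner_zero_left] at this
  exact inner_self_eq_zero.1 this.symm

lemma rep_dense (hπ : IsIrreducibleRep π) {e : A} (he : IsSelfAdjoint e) {ξ : H}
    (h : π e ξ ≠ 0) : DenseRange (fun x : A => π x (π e ξ)) := by
  set ζ := π e ξ
  let L : A →ₗ[ℂ] H :=
    { toFun := fun x => π x ζ
      map_add' := by intros; simp
      map_smul' := by intros; simp }
  have hinv : ∀ (a : A) (v : H), v ∈ (LinearMap.range L).topologicalClosure →
      π a v ∈ (LinearMap.range L).topologicalClosure := by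
    intro a v hv
    refine map_mem_closure (π a).continuous hv ?_
    rintro _ ⟨x, rfl⟩
    exact ⟨a * x, by simp [L]⟩
  rcases hπ.2 _ (Submodule.isClosed_topologicalClosure _) hinv with h1 | h1
  · exfalso
    have : π e ζ ∈ (LinearMap.range L).topologicalClosure :=
      Submodule.le_topologicalClosure _ ⟨e, rfl⟩
    rw [h1, Submodule.mem_bot] at this
    exact rep_sa_ne he h this
  · intro v
    have : v ∈ (LinearMap.range L).topologicalClosure := by rw [h1]; trivial
    exact this

lemma rep_inj (hsimple : ∀ I : TwoSidedIdeal A, IsClosed (I : Set A) → I = ⊥ ∨ I = ⊤)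
    (hπ : IsIrreducibleRep π) : Function.Injective π := by
  have hcont : Continuous π :=
    AddMonoidHomClass.continuous_of_bound π 1 fun x => by
      simpa using NonUnitalStarAlgHom.norm_apply_le π x
  rcases hsimple (TwoSidedIdeal.ker π) (by
    have : ((TwoSidedIdeal.ker π : TwoSidedIdeal A) : Set A) = π ⁻¹' {0} := by
      ext x; simp [TwoSidedIdeal.mem_ker]
    rw [this]; exact isClosed_singleton.preimage hcont) with h | h
  · rw [injective_iff_map_eq_zero]
    intro x hx
    have : x ∈ TwoSidedIdeal.ker π := by rwa [TwoSidedIdeal.mem_ker]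
    rw [h] at this
    simpa using this
  · exfalso
    apply hπ.1
    ext x v
    have : x ∈ TwoSidedIdeal.ker π := by rw [h]; trivial
    rw [TwoSidedIdeal.mem_ker] at this
    simp [this]

lemma exists_mul_ne (hπ : IsIrreducibleRep π) (hinj : Function.Injective π)
    {c e : A} (he : IsSelfAdjoint e) (hc0 : c ≠ 0) (he0 : e ≠ 0) : ∃ x, c * x * e ≠ 0 := by
  by_contra! hcon
  have h1 : π e ≠ 0 := by rwa [Ne, map_eq_zero_iff π hinj]
  obtain ⟨ξ, hξ⟩ : ∃ ξ, π e ξ ≠ 0 := by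
    by_contra! h; exact h1 (ContinuousLinearMap.ext h)
  apply hc0
  rw [← map_eq_zero_iff π hinj]
  have : (fun v => π c v) = fun _ => 0 := by
    refine (rep_dense hπ he hξ).equalizer (π c).continuous continuous_const ?_
    funext x
    have := congrArg (fun T => T ξ) (congrArg π (hcon x))
    simpa using this
  ext v
  exact congrFun this v

lemma compact_mem_range (hinj : Function.Injective π)
    (hr : ∀ u v : H, InnerProductSpace.rankOne ℂ u v ∈ Set.range π)
    (K : H →L[ℂ] H) (hK : IsCompactOperator K) : K ∈ Set.range π := by
  have hclosed : IsClosed (Set.range π) :=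
    (NonUnitalStarAlgHom.isometry π hinj).isClosedEmbedding.isClosed_range
  rw [← hclosed.closure_eq, Metric.mem_closure_iff]
  intro ε hε
  have hcomp := hK.isCompact_closure_image_closedBall (f := (K : H →ₗ[ℂ] H)) 1
  obtain ⟨t, htf, ht⟩ := Metric.totallyBounded_iff.1 hcomp.totallyBounded (ε / 2) (by positivity)
  let S := Submodule.span ℂ t
  have : FiniteDimensional ℂ S := FiniteDimensional.span_of_finite ℂ htf
  let b := stdOrthonormalBasis ℂ S
  have hP : S.starProjection ∘L K ∈ Set.range π := by
    rw [b.starProjection_eq_sum_rankOne]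
    have h : ∀ i, ∃ x, π x = InnerProductSpace.rankOne ℂ ((b i : S) : H)
        (ContinuousLinearMap.adjoint K (b i : S)) := fun i => hr _ _
    choose x hx using h
    refine ⟨∑ i, x i, ?_⟩
    rw [map_sum]
    ext v
    simp [hx, InnerProductSpace.rankOne_apply, ContinuousLinearMap.adjoint_inner_left]
  refine ⟨_, hP, ?_⟩
  rw [dist_eq_norm]
  refine lt_of_le_of_lt (ContinuousLinearMap.opNorm_le_of_unit_norm (C := ε / 2) (𝕜 := ℂ)
    (by positivity) ?_) (by linarith)
  intro v hv
  have hmem : K v ∈ closure (K '' Metric.closedBall 0 1) :=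
    subset_closure ⟨v, by simp [hv], rfl⟩
  obtain ⟨y, hy, hy2⟩ : ∃ y ∈ t, dist (K v) y < ε / 2 := by simpa using ht hmem
  have hyS : y ∈ S := Submodule.subset_span hy
  have := S.starProjection_minimal (K v)
  have h3 : ‖K v - S.starProjection (K v)‖ ≤ ‖K v - y‖ := by
    rw [this]
    exact ciInf_le ⟨0, by rintro _ ⟨z, rfl⟩; positivity⟩ (⟨y, hyS⟩ : S)
  rw [dist_eq_norm] at hy2
  simpa using h3.trans hy2.le

lemma rankOne_mem (hπ : IsIrreducibleRep π) (hinj : Function.Injective π)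
    {c : A} (hc : IsSelfAdjoint c) {η θ : H} (hθ : θ = π c η) (hθ0 : θ ≠ 0)
    (h1 : ∀ v, ∃ k : ℂ, π c v = k • θ) (u v : H) :
    InnerProductSpace.rankOne ℂ u v ∈ Set.range π := by
  have hclosed : IsClosed (Set.range π) :=
    (NonUnitalStarAlgHom.isometry π hinj).isClosedEmbedding.isClosed_range
  have hθ' : π c θ ≠ 0 := by
    rw [hθ]; rw [hθ] at hθ0; exact rep_sa_ne hc hθ0
  have hn : ((‖θ‖ : ℂ) ^ 2) ≠ 0 := by simpa using hθ0
  have hT : InnerProductSpace.rankOne ℂ θ (π c θ) = π (((‖θ‖ : ℂ) ^ 2) • c) := by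
    ext w
    obtain ⟨k, hk⟩ := h1 w
    have h2 := inner_rep (π := π) c θ w
    rw [hc.star_eq, hk, inner_smul_right, inner_self_eq_norm_sq_to_K] at h2
    simp only [InnerProductSpace.rankOne_apply, h2, map_smul, _root_.smul_apply, hk,
      smul_smul]
    congr 1
    simp [mul_comm]
  have hd1 : DenseRange (fun x : A => π x θ) := by
    rw [hθ]; rw [hθ] at hθ0; exact rep_dense hπ hc hθ0
  have hd2 : DenseRange (fun x : A => π x (π c θ)) := rep_dense hπ hc hθ'
  have step1 : ∀ y : A, InnerProductSpace.rankOne ℂ u (π y (π c θ)) ∈ Set.range π := by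
    intro y
    refine hd1.induction_on (p := fun u => InnerProductSpace.rankOne ℂ u (π y (π c θ)) ∈
      Set.range π) u ?_ ?_
    · have hflip : Continuous fun u : H => InnerProductSpace.rankOne ℂ u (π y (π c θ)) :=
        ((InnerProductSpace.rankOne ℂ (E := H) (F := H)).flip (π y (π c θ))).continuous
      exact hclosed.preimage hflip
    · intro x
      refine ⟨x * (((‖θ‖ : ℂ) ^ 2) • c) * star y, ?_⟩
      rw [map_mul, map_mul, ← hT]
      ext w
      simp only [mul_apply_eq_comp, InnerProductSpace.rankOne_apply, map_smul]
      rw [← inner_rep (star y), star_star]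
  refine hd2.induction_on (p := fun v => InnerProductSpace.rankOne ℂ u v ∈ Set.range π) v ?_ step1
  exact hclosed.preimage (InnerProductSpace.rankOne ℂ u).continuous

lemma split [PartialOrder A] [StarOrderedRing A]
    (hπ : IsIrreducibleRep π) (hinj : Function.Injective π)
    {K : H →L[ℂ] H} (hK : IsCompactOperator K) (hKn : K ∉ Set.range π)
    {c : A} (hc : IsSelfAdjoint c) (hc0 : c ≠ 0) :
    ∃ p q : A, 0 ≤ p ∧ 0 ≤ q ∧ p ≠ 0 ∧ q ≠ 0 ∧ p * q = 0 ∧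
      (∃ s, p = c * s * c) ∧ (∃ s, q = c * s * c) := by
  by_contra! hcon
  -- every self-adjoint element of `cAc` is semidefinite
  have semi : ∀ y u : A, IsSelfAdjoint y → y = c * u → (0 ≤ y ∨ 0 ≤ - y) := by
    intro y u hys hy
    have hy' : y = star u * c := by
      rw [← hys.star_eq, hy, star_mul, hc.star_eq]
    have hpm := CFC.posPart_mul_negPart y
    have hmp := CFC.negPart_mul_posPart y
    have hs := CFC.posPart_sub_negPart y hys
    have hp0 : 0 ≤ y⁺ := CFC.posPart_nonneg y
    have hm0 : 0 ≤ y⁻ := CFC.negPart_nonneg y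
    have e1 : y * y⁺ = y⁺ * y⁺ := by nth_rw 1 [← hs]; rw [sub_mul, hmp, sub_zero]
    have e2 : y⁺ * y = y⁺ * y⁺ := by nth_rw 2 [← hs]; rw [mul_sub, hpm, sub_zero]
    have e3 : y * y⁻ = -(y⁻ * y⁻) := by nth_rw 1 [← hs]; rw [sub_mul, hpm, zero_sub]
    have e4 : y⁻ * y = -(y⁻ * y⁻) := by nth_rw 2 [← hs]; rw [mul_sub, hmp, zero_sub]
    have cube : ∀ z : A, IsSelfAdjoint z → z * z * z = 0 → z = 0 := by
      intro z hz h
      have h4 : star (z * z) * (z * z) = 0 := by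
        rw [star_mul, hz.star_eq, ← mul_assoc, h, zero_mul]
      have h5 : star z * z = 0 := by
        rw [hz.star_eq]; exact (CStarRing.star_mul_self_eq_zero_iff _).1 h4
      exact (CStarRing.star_mul_self_eq_zero_iff _).1 h5
    by_cases hp : y⁺ = 0
    · right
      rw [← hs, hp]; simpa using hm0
    by_cases hm : y⁻ = 0
    · left
      rw [← hs, hm]; simpa using hp0
    exfalso
    refine hcon (y * y⁺ * y) (y * y⁻ * y) ?_ ?_ ?_ ?_ ?_ ⟨u * y⁺ * star u, ?_⟩
      (u * y⁻ * star u) ?_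
    · exact hys.conjugate_nonneg hp0
    · exact hys.conjugate_nonneg hm0
    · intro h
      apply hp
      apply cube _ (IsSelfAdjoint.of_nonneg hp0)
      rw [e1, mul_assoc, e2, ← mul_assoc] at h
      exact h
    · intro h
      apply hm
      apply cube _ (IsSelfAdjoint.of_nonneg hm0)
      rw [e3, neg_mul, mul_assoc, e4, mul_neg, neg_neg, ← mul_assoc] at h
      exact h
    · calc y * y⁺ * y * (y * y⁻ * y) = y * (y⁺ * y) * (y * y⁻) * y := by simp only [mul_assoc]
        _ = - (y * y⁺ * (y⁺ * y⁻) * y⁻ * y) := by rw [e2, e3]; simp only [mul_assoc, mul_neg, neg_mul]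
        _ = 0 := by rw [hpm]; simp
    · calc y * y⁺ * y = (c * u) * y⁺ * (star u * c) := by rw [← hy, ← hy']
        _ = _ := by simp only [mul_assoc]
    · calc y * y⁻ * y = (c * u) * y⁻ * (star u * c) := by rw [← hy, ← hy']
        _ = _ := by simp only [mul_assoc]
  have h1 : π c ≠ 0 := by rwa [Ne, map_eq_zero_iff π hinj]
  obtain ⟨ξ, hξ⟩ : ∃ ξ, π c ξ ≠ 0 := by
    by_contra! h; exact h1 (ContinuousLinearMap.ext h)
  set η := π c ξ with hη
  have hθ0 : π c η ≠ 0 := rep_sa_ne hc hξ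
  have psd : ∀ y : A, 0 ≤ y → ⟪π y ξ, ξ⟫_ℂ = 0 → π y ξ = 0 := by
    intro y hy h
    obtain ⟨s, rfl⟩ := CStarAlgebra.nonneg_iff_eq_star_mul_self.1 hy
    rw [map_mul, mul_apply_eq_comp] at h ⊢
    rw [inner_rep] at h
    rw [inner_self_eq_zero.1 h, map_zero]
  -- the self-adjoint case
  have hsa : ∀ x : A, IsSelfAdjoint x → ∃ k : ℂ, π c (π x η) = k • π c η := by
    intro x hx
    have hn : ((‖η‖ : ℂ) ^ 2) ≠ 0 := by simpa using hξ
    set k : ℂ := ⟪π x η, η⟫_ℂ / (‖η‖ : ℂ) ^ 2 with hk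
    have hkr : star k = k := by
      rw [hk, star_div₀]
      congr 1
      · have h2 := inner_rep (π := π) x η η
        rw [hx.star_eq] at h2
        conv_rhs => rw [h2]
        exact inner_conj_symm _ _
      · simp
    set y : A := c * (x * c - k • c) with hy
    have hys : IsSelfAdjoint y := by
      rw [isSelfAdjoint_iff, hy]
      simp only [star_mul, star_sub, star_smul, hkr, hx.star_eq, hc.star_eq, mul_sub, sub_mul,
        mul_assoc, smul_mul_assoc, mul_smul_comm]
    have hyξ : π y ξ = π c (π x η) - k • π c η := by
      simp [hy, hη]
    have hin : ⟪π y ξ, ξ⟫_ℂ = 0 := by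
      have h2 := inner_rep (π := π) c (π x η) ξ
      have h3 := inner_rep (π := π) c η ξ
      rw [hc.star_eq] at h2 h3
      rw [hyξ, inner_sub_left, inner_smul_left, h2, h3, ← hη, inner_self_eq_norm_sq_to_K]
      have : (starRingEnd ℂ) k = k := hkr
      rw [this, hk]
      simp only [Complex.coe_algebraMap]
      rw [div_mul_cancel₀ _ hn, sub_self]
    refine ⟨k, ?_⟩
    rw [← sub_eq_zero, ← hyξ]
    rcases semi y _ hys hy with h | h
    · exact psd y h hin
    · have := psd (-y) h (by simp [hin])
      simpa using this
  have hall : ∀ x : A, ∃ k : ℂ, π c (π x η) = k • π c η := by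
    intro x
    obtain ⟨k1, hk1⟩ := hsa _ (realPart x).2
    obtain ⟨k2, hk2⟩ := hsa _ (imaginaryPart x).2
    refine ⟨k1 + Complex.I * k2, ?_⟩
    conv_lhs => rw [← realPart_add_I_smul_imaginaryPart x]
    simp only [map_add, map_smul, _root_.add_apply, _root_.smul_apply,
      hk1, hk2, add_smul, smul_smul]
  have hrk : ∀ v, ∃ k : ℂ, π c v = k • π c η := by
    intro v
    have hcl : IsClosed ((Submodule.span ℂ {π c η} : Submodule ℂ H) : Set H) :=
      Submodule.closed_of_finiteDimensional _
    have : π c v ∈ Submodule.span ℂ {π c η} := by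
      refine (rep_dense hπ hc hξ).induction_on
        (p := fun v => π c v ∈ Submodule.span ℂ {π c η}) v (hcl.preimage (π c).continuous) ?_
      intro x
      obtain ⟨k, hk⟩ := hall x
      exact Submodule.mem_span_singleton.2 ⟨k, hk.symm⟩
    obtain ⟨k, hk⟩ := Submodule.mem_span_singleton.1 this
    exact ⟨k, hk.symm⟩
  exact hKn (compact_mem_range hinj (rankOne_mem hπ hinj hc rfl hθ0 hrk) K hK)

end Rep

section Main

variable {A H : Type} [NonUnitalCStarAlgebra A] [NormedAddCommGroup H]
    [InnerProductSpace ℂ H] [CompleteSpace H] {π : A →⋆ₙₐ[ℂ] (H →L[ℂ] H)}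
    [PartialOrder A] [StarOrderedRing A]

lemma exists_orth (hπ : IsIrreducibleRep π) (hinj : Function.Injective π)
    {K : H →L[ℂ] H} (hK : IsCompactOperator K) (hKn : K ∉ Set.range π) (l : ℕ) :
    ∀ a : A, 0 ≤ a → a ≠ 0 → ∃ c : Fin l → A, (∀ j, 0 ≤ c j) ∧ (∀ j, c j ≠ 0) ∧
      (∀ j k, j ≠ k → c j * c k = 0) ∧ ∀ j, ∃ s, c j = a * s * a := by
  induction l with
  | zero => exact fun a _ _ => ⟨Fin.elim0, fun j => j.elim0, fun j => j.elim0,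
      fun j => j.elim0, fun j => j.elim0⟩
  | succ l ih =>
    intro a ha ha0
    obtain ⟨p, q, hp, hq, hp0, hq0, hpq, ⟨s, hs⟩, ⟨t, ht⟩⟩ :=
      split hπ hinj hK hKn (IsSelfAdjoint.of_nonneg ha) ha0
    have hqp : q * p = 0 := by
      have := congrArg star hpq
      rwa [star_mul, (IsSelfAdjoint.of_nonneg hp).star_eq, (IsSelfAdjoint.of_nonneg hq).star_eq,
        star_zero] at this
    obtain ⟨c, h1, h2, h3, h4⟩ := ih q hq hq0
    refine ⟨Fin.cons p c, ?_, ?_, ?_, ?_⟩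
    · intro j; refine Fin.cases ?_ (fun j => ?_) j <;> simp [hp, h1]
    · intro j; refine Fin.cases ?_ (fun j => ?_) j <;> simp [hp0, h2]
    · intro j k
      refine Fin.cases ?_ (fun j => ?_) j <;> refine Fin.cases ?_ (fun k => ?_) k
      · simp
      · intro _
        obtain ⟨r, hr⟩ := h4 k
        simp [hr, ← mul_assoc, hpq]
      · intro _
        obtain ⟨r, hr⟩ := h4 j
        simp [hr, mul_assoc, hqp]
      · intro hjk
        simpa using h3 j k (fun h => hjk (by rw [h]))
    · intro j
      refine Fin.cases ?_ (fun j => ?_) j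
      · exact ⟨s, by simpa using hs⟩
      · obtain ⟨r, hr⟩ := h4 j
        refine ⟨t * a * r * a * t, ?_⟩
        simp only [Fin.cons_succ, hr, ht, mul_assoc]

lemma exists_common (hπ : IsIrreducibleRep π) (hinj : Function.Injective π)
    (a : A) (ha : 0 ≤ a) (ha0 : a ≠ 0) (l : ℕ) :
    ∀ c : Fin l → A, (∀ j, c j ≠ 0) →
      ∃ e : A, 0 ≤ e ∧ e ≠ 0 ∧ ∀ j, ∃ t : A, ∀ s : A,
        CuntzEquiv A ((c j * t) * (e * s * e) * star (c j * t)) (e * s * e) := by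
  induction l with
  | zero => exact fun c _ => ⟨a, ha, ha0, fun j => j.elim0⟩
  | succ l ih =>
    intro c hc
    obtain ⟨e, he, he0, h⟩ := ih (fun j => c j.succ) (fun j => hc _)
    obtain ⟨x, hx⟩ := exists_mul_ne hπ hinj (IsSelfAdjoint.of_nonneg he) (hc 0) he0
    set z := c 0 * x * e with hz
    have hes : star e = e := (IsSelfAdjoint.of_nonneg he).star_eq
    have hzz : star z * z = e * (star x * star (c 0) * c 0 * x) * e := by
      rw [hz]; simp [mul_assoc, hes]
    refine ⟨star z * z, star_mul_self_nonneg z,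
      fun h0 => hx ((CStarRing.star_mul_self_eq_zero_iff _).1 h0), ?_⟩
    intro j
    refine Fin.cases ?_ (fun j => ?_) j
    · refine ⟨x * e, fun s => ⟨sub_conj _ _, ?_⟩⟩
      rw [← mul_assoc (c 0) x e, ← hz]
      refine sub_trans (sub_compress (IsSelfAdjoint.star_mul_self z) s) ?_
      have := sub_conj (z * (star z * z * s * (star z * z)) * star z) (star z)
      simpa only [star_star, mul_assoc] using this
    · obtain ⟨t, ht⟩ := h j
      refine ⟨t, fun s => ?_⟩
      have := ht ((star x * star (c 0) * c 0 * x) * e * s * e * (star x * star (c 0) * c 0 * x))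
      rw [hzz]
      simpa only [mul_assoc] using this

end Main

end OrthEq

theorem exists_orthogonal_equivalent_elements {A : Type} [NonUnitalCStarAlgebra A]
    [PartialOrder A] [StarOrderedRing A]
    (hsimple : ∀ I : TwoSidedIdeal A, IsClosed (I : Set A) → I = ⊥ ∨ I = ⊤)
    (htype : ¬ IsTypeI A)
    (a : A) (ha : 0 ≤ a) (ha0 : a ≠ 0) (l : ℕ) (hl : 0 < l) :
    ∃ b : Fin l → A,
      (∀ j, 0 ≤ b j) ∧ (∀ j, b j ≠ 0) ∧
      (∀ j k, CuntzEquiv A (b j) (b k)) ∧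
      (∀ j k, j ≠ k → b j * b k = 0) ∧
      (∑ j, b j) ∈ closure {y : A | ∃ d, y = a * d * a} := by
  unfold IsTypeI at htype
  push Not at htype
  obtain ⟨H, i1, i2, i3, π, hπ, K, hK, hKn⟩ := htype
  have hinj := OrthEq.rep_inj hsimple hπ
  obtain ⟨c, hc, hc0, hcc, hca⟩ := OrthEq.exists_orth hπ hinj hK hKn l a ha ha0
  obtain ⟨e, he, he0, h⟩ := OrthEq.exists_common hπ hinj a ha ha0 l c hc0
  choose t ht using h
  choose r hr using hca
  have hes : star e = e := (IsSelfAdjoint.of_nonneg he).star_eq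
  have hcs : ∀ j, star (c j) = c j := fun j => (IsSelfAdjoint.of_nonneg (hc j)).star_eq
  have heee : 0 ≤ e * e * e := (IsSelfAdjoint.of_nonneg he).conjugate_nonneg he
  have hee0 : e * e * e ≠ 0 := by
    intro h0
    have h4 : star (e * e) * (e * e) = 0 := by
      rw [star_mul, hes, ← mul_assoc, h0, zero_mul]
    have h5 : star e * e = 0 := by
      rw [hes]; exact (CStarRing.star_mul_self_eq_zero_iff _).1 h4
    exact he0 ((CStarRing.star_mul_self_eq_zero_iff _).1 h5)
  refine ⟨fun j => (c j * t j) * (e * e * e) * star (c j * t j), ?_, ?_, ?_, ?_, ?_⟩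
  · exact fun j => star_right_conjugate_nonneg heee _
  · exact fun j => OrthEq.ne_zero_of_sub (ht j e).2 hee0
  · exact fun j k => ⟨OrthEq.sub_trans (ht j e).1 (ht k e).2, OrthEq.sub_trans (ht k e).1 (ht j e).2⟩
  · intro j k hjk
    have h0 := hcc j k hjk
    calc _ = c j * t j * (e * e * e) * star (t j) * (c j * c k) *
          (t k * (e * e * e) * star (c k * t k)) := by
            simp only [star_mul, hcs, mul_assoc]
      _ = 0 := by rw [h0]; simp
  · apply subset_closure
    refine ⟨∑ j, r j * a * t j * (e * e * e) * star (t j) * a * r j, ?_⟩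
    rw [Finset.mul_sum, Finset.sum_mul]
    refine Finset.sum_congr rfl fun j _ => ?_
    beta_reduce
    rw [star_mul, hcs]
    conv_lhs => rw [hr j]
    simp only [mul_assoc]
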